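/- With the notation of the context, there exists a constant C > 0 depending only on K such that for every nonzero integral ideal 𝔪 of 𝓞, every ν ∈ 𝓞 and every x ≥ 1, |𝒩(x; 𝔪, ν) − 𝒩(x)/N𝔪| ≤ C·x^{1−1/n}. -/

import Mathlib

set_option synthInstance.maxHeartbeats 1000000
set_option maxHeartbeats 2000000

open NumberField
open scoped Classical

noncomputable section

variable {K : Type*} [Field K] [NumberField K]

/-- An element of `𝓞 K` is totally positive if it is positive under every real embedding. -/
def TotPos (α : 𝓞 K) : Prop := ∀ v : K →+* ℝ, 0 < v (α : K)

/-- Membership in the closure `𝒟̄` of the Shintani-type fundamental domain: `α` is totally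
positive and `∑ᵢ vᵢ(u) vᵢ(α) ≥ ∑ᵢ vᵢ(α)` for every totally positive unit `u`. -/
def InDbar (α : 𝓞 K) : Prop :=
  TotPos α ∧ ∀ u : (𝓞 K)ˣ, TotPos (u : 𝓞 K) →
    ∑ v : K →+* ℝ, v ((u : 𝓞 K) : K) * v (α : K) ≥ ∑ v : K →+* ℝ, v (α : K)

/-- `𝒩(x)`: the number of `α ∈ 𝒟̄ ∩ 𝓞 K` with `Nα ≤ x`. -/
def Ncount (x : ℝ) : ℕ :=
  Nat.card {α : 𝓞 K // InDbar α ∧ ((Algebra.norm ℤ α : ℤ) : ℝ) ≤ x}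

/-- `𝒩(x; 𝔪, ν)`: the number of `α ∈ 𝒟̄ ∩ 𝓞 K` with `Nα ≤ x` and `α ≡ ν (mod 𝔪)`. -/
def NcountCong (x : ℝ) (𝔪 : Ideal (𝓞 K)) (ν : 𝓞 K) : ℕ :=
  Nat.card {α : 𝓞 K // InDbar α ∧ ((Algebra.norm ℤ α : ℤ) : ℝ) ≤ x ∧ α - ν ∈ 𝔪}

/-- The real embeddings of a totally real field correspond to its complex embeddings. -/
def realEmbeddingEquiv (htr : ∀ φ : K →+* ℂ, ComplexEmbedding.IsReal φ) :
    (K →+* ℝ) ≃ (K →+* ℂ) where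
  toFun v := Complex.ofRealHom.comp v
  invFun φ := (htr φ).embedding
  left_inv v := by
    ext x
    have := ComplexEmbedding.IsReal.coe_embedding_apply (htr (Complex.ofRealHom.comp v)) x
    exact Complex.ofReal_injective this
  right_inv φ := by
    ext x
    exact ComplexEmbedding.IsReal.coe_embedding_apply (htr φ) x

theorem card_realEmbedding (htr : ∀ φ : K →+* ℂ, ComplexEmbedding.IsReal φ) :
    Fintype.card (K →+* ℝ) = Module.finrank ℚ K := by
  rw [Fintype.card_congr (realEmbeddingEquiv htr), Embeddings.card]

theorem norm_eq_prod_realEmbedding (htr : ∀ φ : K →+* ℂ, ComplexEmbedding.IsReal φ) (α : 𝓞 K) :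
    ((Algebra.norm ℤ α : ℤ) : ℝ) = ∏ v : K →+* ℝ, v (α : K) := by
  apply Complex.ofReal_injective
  have h := Algebra.norm_eq_prod_embeddings ℚ ℂ (α : K)
  rw [← Algebra.coe_norm_int] at h
  have h2 : ∏ σ : K →ₐ[ℚ] ℂ, σ (α : K) = ∏ σ : K →+* ℂ, σ (α : K) :=
    Fintype.prod_equiv (RingHom.equivRatAlgHom K ℂ).symm _ _ (fun σ => rfl)
  rw [h2, ← (realEmbeddingEquiv htr).prod_comp] at h
  push_cast
  simpa [realEmbeddingEquiv] using h

theorem finite_of_realEmbedding_abs_le (htr : ∀ φ : K →+* ℂ, ComplexEmbedding.IsReal φ) (B : ℝ) :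
    {α : 𝓞 K | ∀ v : K →+* ℝ, |v (α : K)| ≤ B}.Finite := by
  refine ((Embeddings.finite_of_norm_le K ℂ B).preimage
    (RingOfIntegers.coe_injective.injOn)).subset ?_
  intro α hα
  refine ⟨α.isIntegral_coe, fun φ => ?_⟩
  obtain ⟨v, rfl⟩ := (realEmbeddingEquiv htr).surjective φ
  simpa [realEmbeddingEquiv] using hα v

theorem exists_totPos_unit_lt_one (htr : ∀ φ : K →+* ℂ, ComplexEmbedding.IsReal φ)
    (v₀ : K →+* ℝ) :
    ∃ u : (𝓞 K)ˣ, TotPos (u : 𝓞 K) ∧ ∀ v : K →+* ℝ, v ≠ v₀ → v ((u : 𝓞 K) : K) < 1 := by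
  obtain ⟨w, hw⟩ := Units.dirichletUnitTheorem.exists_unit K
    (InfinitePlace.mk (realEmbeddingEquiv htr v₀))
  have hne : ∀ v : K →+* ℝ, v ((w : 𝓞 K) : K) ≠ 0 := fun v => by simp
  refine ⟨w ^ 2, fun v => ?_, fun v hv => ?_⟩
  · have := hne v
    push_cast
    rw [map_pow]
    positivity
  · have hmk : InfinitePlace.mk (realEmbeddingEquiv htr v) ≠
        InfinitePlace.mk (realEmbeddingEquiv htr v₀) := by
      rw [Ne, InfinitePlace.mk_eq_iff, ComplexEmbedding.isReal_iff.mp (htr _), or_self]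
      exact fun h => hv ((realEmbeddingEquiv htr).injective h)
    have h := hw _ hmk
    rw [InfinitePlace.apply] at h
    have h1 : ‖realEmbeddingEquiv htr v ((w : 𝓞 K) : K)‖ = |v ((w : 𝓞 K) : K)| := by
      simp [realEmbeddingEquiv]
    rw [h1, Real.log_abs] at h
    push_cast
    rw [map_pow, sq_lt_one_iff_abs_lt_one]
    by_contra! hge
    rw [← Real.log_abs] at h
    exact absurd (Real.log_nonneg hge) (not_le.mpr h)

theorem exists_ratio_bound (htr : ∀ φ : K →+* ℂ, ComplexEmbedding.IsReal φ) :
    ∃ κ : ℝ, 1 ≤ κ ∧ ∀ α : 𝓞 K, InDbar α → ∀ v w : K →+* ℝ, v (α : K) ≤ κ * w (α : K) := by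
  choose u hpos hlt using exists_totPos_unit_lt_one htr
  let c : (K →+* ℝ) → (K →+* ℝ) → ℝ := fun v w =>
    |(w ((u w : 𝓞 K) : K) - 1) / (1 - v ((u w : 𝓞 K) : K))|
  have hc : ∀ v w, 0 ≤ c v w := fun v w => abs_nonneg _
  refine ⟨1 + ∑ v, ∑ w, c v w, ?_, fun α hα v w => ?_⟩
  · have : 0 ≤ ∑ v, ∑ w, c v w :=
      Finset.sum_nonneg fun v _ => Finset.sum_nonneg fun w _ => hc v w
    linarith
  have hle : c v w ≤ ∑ v, ∑ w, c v w :=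
    (Finset.single_le_sum (f := fun w => c v w) (fun w _ => hc v w) (Finset.mem_univ w)).trans
      (Finset.single_le_sum (f := fun v => ∑ w, c v w)
        (fun v _ => Finset.sum_nonneg fun w _ => hc v w) (Finset.mem_univ v))
  have hw0 := hα.1 w
  rcases eq_or_ne v w with rfl | hvw
  · nlinarith [hc v v]
  have h1 := hα.2 (u w) (hpos w)
  have h2 : 0 ≤ ∑ t : K →+* ℝ, (t ((u w : 𝓞 K) : K) - 1) * t (α : K) := by
    simp only [sub_mul, one_mul, Finset.sum_sub_distrib]
    linarith
  rw [← Finset.add_sum_erase _ _ (Finset.mem_univ w)] at h2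
  have h3 : ∑ t ∈ Finset.univ.erase w, (t ((u w : 𝓞 K) : K) - 1) * t (α : K) ≤
      (v ((u w : 𝓞 K) : K) - 1) * v (α : K) := by
    rw [← Finset.add_sum_erase (Finset.univ.erase w) _
      (Finset.mem_erase.mpr ⟨hvw, Finset.mem_univ v⟩)]
    have : ∑ t ∈ (Finset.univ.erase w).erase v, (t ((u w : 𝓞 K) : K) - 1) * t (α : K) ≤ 0 := by
      refine Finset.sum_nonpos fun t ht => ?_
      have htw : t ≠ w := (Finset.mem_erase.mp (Finset.mem_erase.mp ht).2).1
      nlinarith [hlt w t htw, hα.1 t]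
    linarith
  have h4 : 0 < 1 - v ((u w : 𝓞 K) : K) := by linarith [hlt w v hvw]
  have h5 : v (α : K) ≤ (w ((u w : 𝓞 K) : K) - 1) / (1 - v ((u w : 𝓞 K) : K)) * w (α : K) := by
    rw [div_mul_eq_mul_div, le_div_iff₀ h4]
    linarith
  have h6 : (w ((u w : 𝓞 K) : K) - 1) / (1 - v ((u w : 𝓞 K) : K)) ≤ c v w := le_abs_self _
  calc v (α : K) ≤ _ := h5
    _ ≤ (1 + ∑ v, ∑ w, c v w) * w (α : K) := by gcongr; linarith

theorem eq_of_sub_mem_of_abs_lt (htr : ∀ φ : K →+* ℂ, ComplexEmbedding.IsReal φ)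
    (𝔪 : Ideal (𝓞 K)) {r : ℝ} (hr : r ^ Module.finrank ℚ K ≤ Ideal.absNorm 𝔪)
    {α β : 𝓞 K} (h : α - β ∈ 𝔪) (hlt : ∀ v : K →+* ℝ, |v (α : K) - v (β : K)| < r) :
    α = β := by
  by_contra hne
  have h0 : α - β ≠ 0 := sub_ne_zero.mpr hne
  have hdvd : Ideal.absNorm 𝔪 ∣ (Algebra.norm ℤ (α - β)).natAbs := by
    rw [← Ideal.absNorm_span_singleton]
    exact Ideal.absNorm_dvd_absNorm_of_le ((Ideal.span_singleton_le_iff_mem _).mpr h)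
  have hle : Ideal.absNorm 𝔪 ≤ (Algebra.norm ℤ (α - β)).natAbs :=
    Nat.le_of_dvd (Int.natAbs_pos.mpr (Algebra.norm_ne_zero_iff.mpr h0)) hdvd
  have hle' : (Ideal.absNorm 𝔪 : ℝ) ≤ ∏ v : K →+* ℝ, |v (α : K) - v (β : K)| := by
    have : ((Algebra.norm ℤ (α - β)).natAbs : ℝ) = ∏ v : K →+* ℝ, |v (α : K) - v (β : K)| := by
      rw [Nat.cast_natAbs, Int.cast_abs, norm_eq_prod_realEmbedding htr, Finset.abs_prod]
      simp
    rw [← this]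
    exact_mod_cast hle
  have hlt' : ∏ v : K →+* ℝ, |v (α : K) - v (β : K)| < ∏ v : K →+* ℝ, r := by
    refine Finset.prod_lt_prod_of_nonempty (fun v _ => ?_) (fun v _ => hlt v) ?_
    · rw [← map_sub]
      have : v ((α : K) - (β : K)) ≠ 0 := by
        rw [map_ne_zero, ← map_sub]
        exact RingOfIntegers.coe_ne_zero_iff.mpr h0
      positivity
    · rw [← Finset.card_pos, Finset.card_univ, card_realEmbedding htr]
      exact Module.finrank_pos
  rw [Finset.prod_const, Finset.card_univ, card_realEmbedding htr] at hlt'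
  linarith

theorem exists_short_mem_ideal (K : Type*) [Field K] [NumberField K] :
    ∃ C : ℝ, 0 ≤ C ∧ ∀ 𝔪 : Ideal (𝓞 K), 𝔪 ≠ ⊥ → ∀ r : ℝ, 0 ≤ r →
      r ^ Module.finrank ℚ K = Ideal.absNorm 𝔪 →
      ∃ β ∈ 𝔪, β ≠ 0 ∧ ∀ v : K →+* ℝ, |v (β : K)| ≤ C * r := by
  let ι := Module.Free.ChooseBasisIndex ℤ (𝓞 K)
  let b := RingOfIntegers.basis K
  refine ⟨∑ v : K →+* ℝ, ∑ i : ι, |v (b i : K)|,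
    Finset.sum_nonneg fun v _ => Finset.sum_nonneg fun i _ => abs_nonneg _,
    fun 𝔪 h𝔪 r hr hrn => ?_⟩
  have : Finite (𝓞 K ⧸ 𝔪) := Ideal.finiteQuotientOfFreeOfNeBot 𝔪 h𝔪
  have := Fintype.ofFinite (𝓞 K ⧸ 𝔪)
  let T : (ι → Fin (⌊r⌋₊ + 1)) → 𝓞 K := fun a => ∑ i, ((a i : ℕ) : ℤ) • b i
  have hcard : Fintype.card (𝓞 K ⧸ 𝔪) < Fintype.card (ι → Fin (⌊r⌋₊ + 1)) := by
    rw [Fintype.card_fun, Fintype.card_fin, ← Module.finrank_eq_card_chooseBasisIndex,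
      RingOfIntegers.rank]
    have h1 : (Fintype.card (𝓞 K ⧸ 𝔪) : ℝ) = Ideal.absNorm 𝔪 := by
      rw [Ideal.absNorm_apply, Submodule.cardQuot_apply, Nat.card_eq_fintype_card]
    have h2 : r ^ Module.finrank ℚ K < ((⌊r⌋₊ : ℝ) + 1) ^ Module.finrank ℚ K :=
      pow_lt_pow_left₀ (Nat.lt_floor_add_one r) hr Module.finrank_pos.ne'
    rw [hrn, ← h1] at h2
    exact_mod_cast h2
  obtain ⟨a, a', hne, heq⟩ := Fintype.exists_ne_map_eq_of_card_lt
    (fun a => Ideal.Quotient.mk 𝔪 (T a)) hcard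
  have hsub : T a - T a' = ∑ i, (((a i : ℕ) : ℤ) - ((a' i : ℕ) : ℤ)) • b i := by
    simp only [T, sub_smul, Finset.sum_sub_distrib]
  refine ⟨T a - T a', Ideal.Quotient.eq.mp heq, fun h0 => hne ?_, fun v => ?_⟩
  · rw [hsub] at h0
    funext i
    have := Fintype.linearIndependent_iff.mp b.linearIndependent _ h0 i
    apply Fin.ext
    omega
  · have hv : v ((T a - T a' : 𝓞 K) : K) =
        ∑ i, (((a i : ℕ) : ℝ) - ((a' i : ℕ) : ℝ)) * v (b i : K) := by
      rw [hsub]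
      simp [zsmul_eq_mul]
    have hfl : ∀ c : Fin (⌊r⌋₊ + 1), ((c : ℕ) : ℝ) ≤ r := fun c =>
      (Nat.cast_le.mpr (Nat.lt_succ_iff.mp c.2)).trans (Nat.floor_le hr)
    rw [hv]
    calc |∑ i, (((a i : ℕ) : ℝ) - ((a' i : ℕ) : ℝ)) * v (b i : K)|
        ≤ ∑ i, |(((a i : ℕ) : ℝ) - ((a' i : ℕ) : ℝ)) * v (b i : K)| :=
          Finset.abs_sum_le_sum_abs _ _
      _ ≤ ∑ i, |v (b i : K)| * r := by
          refine Finset.sum_le_sum fun i _ => ?_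
          rw [abs_mul, mul_comm]
          gcongr
          have h1 := hfl (a i)
          have h2 := hfl (a' i)
          have h3 : (0 : ℝ) ≤ (a i : ℕ) := Nat.cast_nonneg _
          have h4 : (0 : ℝ) ≤ (a' i : ℕ) := Nat.cast_nonneg _
          rw [abs_le]
          constructor <;> linarith
      _ = (∑ i, |v (b i : K)|) * r := by rw [Finset.sum_mul]
      _ ≤ _ := by
          gcongr
          exact Finset.single_le_sum (f := fun v : K →+* ℝ => ∑ i : ι, |v (b i : K)|)
            (fun v _ => Finset.sum_nonneg fun i _ => abs_nonneg _) (Finset.mem_univ v)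

theorem exists_short_representative (K : Type*) [Field K] [NumberField K] :
    ∃ C : ℝ, 0 ≤ C ∧ ∀ 𝔪 : Ideal (𝓞 K), 𝔪 ≠ ⊥ → ∀ r : ℝ, 0 ≤ r →
      r ^ Module.finrank ℚ K = Ideal.absNorm 𝔪 →
      ∀ δ : 𝓞 K, ∃ δ' : 𝓞 K, δ - δ' ∈ 𝔪 ∧ ∀ v : K →+* ℝ, |v (δ' : K)| ≤ C * r := by
  obtain ⟨C, hC, hmem⟩ := exists_short_mem_ideal K
  let ι := Module.Free.ChooseBasisIndex ℤ (𝓞 K)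
  let b := RingOfIntegers.basis K
  let D : ℝ := ∑ v : K →+* ℝ, ∑ i : ι, |v (b i : K)|
  have hD : 0 ≤ D := Finset.sum_nonneg fun v _ => Finset.sum_nonneg fun i _ => abs_nonneg _
  refine ⟨C * D, mul_nonneg hC hD, fun 𝔪 h𝔪 r hr hrn δ => ?_⟩
  obtain ⟨β, hβ, hβ0, hle⟩ := hmem 𝔪 h𝔪 r hr hrn
  have hβK : (β : K) ≠ 0 := by simpa using hβ0
  let q : ι → ℚ := (integralBasis K).repr ((δ : K) / (β : K))
  have hq : ∑ i, q i • (b i : K) = (δ : K) / (β : K) := by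
    rw [← (integralBasis K).sum_repr ((δ : K) / (β : K))]
    simp only [integralBasis_apply]
    rfl
  let t : 𝓞 K := ∑ i, ⌊q i⌋ • b i
  refine ⟨δ - β * t, by simpa using 𝔪.mul_mem_right t hβ, fun v => ?_⟩
  have hδ : ((δ - β * t : 𝓞 K) : K) = (β : K) * ∑ i, (Int.fract (q i) : ℚ) • (b i : K) := by
    have ht : (t : K) = ∑ i, ((⌊q i⌋ : ℤ) : ℚ) • (b i : K) := by
      simp [t, Algebra.smul_def]
    have : ∑ i, (Int.fract (q i) : ℚ) • (b i : K) = (δ : K) / (β : K) - (t : K) := by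
      rw [← hq, ht, ← Finset.sum_sub_distrib]
      simp only [← sub_smul, Int.self_sub_floor]
    rw [this]
    push_cast
    field_simp
  have hs : |v (∑ i, (Int.fract (q i) : ℚ) • (b i : K))| ≤ D := by
    rw [map_sum]
    refine (Finset.abs_sum_le_sum_abs _ _).trans (le_trans (Finset.sum_le_sum fun i _ => ?_)
      (Finset.single_le_sum (f := fun v : K →+* ℝ => ∑ i : ι, |v (b i : K)|)
            (fun v _ => Finset.sum_nonneg fun i _ => abs_nonneg _) (Finset.mem_univ v)))
    have hf0 : (0 : ℝ) ≤ (Int.fract (q i) : ℚ) := by exact_mod_cast Int.fract_nonneg _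
    have hf1 : ((Int.fract (q i) : ℚ) : ℝ) ≤ 1 := by exact_mod_cast (Int.fract_lt_one _).le
    rw [Algebra.smul_def, map_mul, abs_mul, eq_ratCast, map_ratCast, abs_of_nonneg hf0]
    exact mul_le_of_le_one_left (abs_nonneg _) hf1
  rw [hδ, map_mul, abs_mul]
  calc |v (β : K)| * |v (∑ i, (Int.fract (q i) : ℚ) • (b i : K))|
      ≤ (C * r) * D := mul_le_mul (hle v) hs (abs_nonneg _) (mul_nonneg hC hr)
    _ = C * D * r := by ring

/-- A set of pairwise congruent integers, lying in a box of side `L` and such that the coordinate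
at `v₀` is determined up to `M r` by the other coordinates, has `O(L ^ (n - 1))` elements. -/
theorem ncard_le_of_slab (htr : ∀ φ : K →+* ℂ, ComplexEmbedding.IsReal φ)
    (𝔪 : Ideal (𝓞 K)) {r : ℝ} (hr1 : 1 ≤ r) (hr : r ^ Module.finrank ℚ K = Ideal.absNorm 𝔪)
    (v₀ : K →+* ℝ) {L : ℝ} (hL : 1 ≤ L) (M : ℕ) (S : Set (𝓞 K))
    (hdiff : ∀ α ∈ S, ∀ β ∈ S, α - β ∈ 𝔪)
    (hbox : ∀ α ∈ S, ∀ v : K →+* ℝ, 0 ≤ v (α : K) ∧ v (α : K) ≤ L)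
    (hslab : ∀ α ∈ S, ∀ β ∈ S, (∀ v : K →+* ℝ, v ≠ v₀ → |v (α : K) - v (β : K)| < r) →
      v₀ (β : K) - v₀ (α : K) ≤ M * r) :
    S.Finite ∧ (S.ncard : ℝ) ≤ (M + 2) * (2 * L) ^ (Module.finrank ℚ K - 1) := by
  have hr0 : 0 < r := by linarith
  have hfloor : ∀ x y : ℝ, 0 ≤ x → 0 ≤ y → ⌊x / r⌋₊ = ⌊y / r⌋₊ → |x - y| < r := by
    intro x y hx hy hxy
    have h1 := Nat.floor_le (div_nonneg hx hr0.le)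
    have h2 := Nat.floor_le (div_nonneg hy hr0.le)
    have h3 := Nat.lt_floor_add_one (x / r)
    have h4 := Nat.lt_floor_add_one (y / r)
    rw [hxy] at h1 h3
    rw [le_div_iff₀ hr0] at h1 h2
    rw [div_lt_iff₀ hr0] at h3 h4
    rw [abs_lt]
    constructor <;> linarith
  let B : ℕ := ⌊L / r⌋₊
  have hlt : ∀ α ∈ S, ∀ v : K →+* ℝ, ⌊v (α : K) / r⌋₊ < B + 1 := fun α hα v =>
    Nat.lt_succ_iff.mpr (Nat.floor_le_floor (by gcongr; exact (hbox α hα v).2))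
  let g : S → ({v : K →+* ℝ // v ≠ v₀} → Fin (B + 1)) × Fin (M + 2) := fun α =>
    (fun v => ⟨⌊v.1 (α.1 : K) / r⌋₊, hlt α.1 α.2 v.1⟩,
      ⟨⌊v₀ (α.1 : K) / r⌋₊ % (M + 2), Nat.mod_lt _ (by omega)⟩)
  have hfl : ∀ α ∈ S, ∀ β ∈ S, v₀ (β : K) - v₀ (α : K) ≤ M * r →
      (⌊v₀ (β : K) / r⌋₊ : ℝ) - ⌊v₀ (α : K) / r⌋₊ < M + 2 := by
    intro α hα β hβ h
    have h1 := Nat.floor_le (div_nonneg (hbox β hβ v₀).1 hr0.le)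
    have h2 := Nat.lt_floor_add_one (v₀ (α : K) / r)
    have h3 : v₀ (β : K) / r - v₀ (α : K) / r ≤ M := by
      rw [← sub_div, div_le_iff₀ hr0]
      exact h
    linarith
  have hg : Function.Injective g := by
    rintro ⟨α, hα⟩ ⟨β, hβ⟩ hαβ
    simp only [g, Prod.mk.injEq, funext_iff, Fin.mk.injEq, Subtype.forall] at hαβ
    obtain ⟨h1, h2⟩ := hαβ
    have h3 : ∀ v : K →+* ℝ, v ≠ v₀ → |v (α : K) - v (β : K)| < r := fun v hv =>
      hfloor _ _ (hbox α hα v).1 (hbox β hβ v).1 (h1 v hv)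
    have h4 := hfl α hα β hβ (hslab α hα β hβ h3)
    have h5 := hfl β hβ α hα (hslab β hβ α hα fun v hv => by
      rw [abs_sub_comm]
      exact h3 v hv)
    have h6 : ⌊v₀ (α : K) / r⌋₊ = ⌊v₀ (β : K) / r⌋₊ := by
      refine Nat.ModEq.eq_of_abs_lt h2 ?_
      rw [abs_lt]
      constructor
      · have : (⌊v₀ (α : K) / r⌋₊ : ℤ) - ⌊v₀ (β : K) / r⌋₊ < ((M + 2 : ℕ) : ℤ) := by
          exact_mod_cast h5
        linarith
      · exact_mod_cast h4
    apply Subtype.ext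
    refine eq_of_sub_mem_of_abs_lt htr 𝔪 hr.le (hdiff α hα β hβ) fun v => ?_
    by_cases hv : v = v₀
    · subst hv
      exact hfloor _ _ (hbox α hα v).1 (hbox β hβ v).1 h6
    · exact h3 v hv
  have hfin : Finite S := Finite.of_injective g hg
  refine ⟨hfin, ?_⟩
  have hcard := Nat.card_le_card_of_injective g hg
  have hcompl : Nat.card {v : K →+* ℝ // v ≠ v₀} = Module.finrank ℚ K - 1 := by
    rw [Nat.card_eq_fintype_card, Fintype.card_subtype_compl, Fintype.card_subtype_eq,
      card_realEmbedding htr]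
  rw [Nat.card_prod, Nat.card_fun, Nat.card_fin, Nat.card_fin, hcompl,
    Nat.card_coe_set_eq] at hcard
  calc (S.ncard : ℝ) ≤ (((B + 1) ^ (Module.finrank ℚ K - 1) * (M + 2) : ℕ) : ℝ) := by
        exact_mod_cast hcard
    _ = (M + 2) * ((B : ℝ) + 1) ^ (Module.finrank ℚ K - 1) := by push_cast; ring
    _ ≤ _ := by
        have h1 : (B : ℝ) ≤ L / r := Nat.floor_le (by positivity)
        have h2 : L / r ≤ L := div_le_self (by linarith) hr1
        gcongr
        linarith

theorem prod_le_prod_of_shift {V : Type*} [Fintype V] {y z : V → ℝ} {v₀ : V} {κ c d r : ℝ}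
    (hy : ∀ v, 0 < y v) (hz : ∀ v, 0 < z v) (hκ : 0 ≤ κ) (hc : 0 ≤ c) (hr : 0 ≤ r)
    (hratio : ∀ v, y v₀ ≤ κ * y v) (hother : ∀ v, v ≠ v₀ → z v ≤ y v + c * r)
    (hv₀ : z v₀ ≤ y v₀ - d * r) (hd : Fintype.card V * (κ * c) ≤ d) :
    ∏ v, z v ≤ ∏ v, y v := by
  have hY := hy v₀
  let t : ℝ := r / y v₀
  have ht : 0 ≤ t := div_nonneg hr hY.le
  have htr : t * y v₀ = r := div_mul_cancel₀ _ hY.ne'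
  let e : V → ℝ := fun v => if v = v₀ then -(d * t) else κ * c * t
  have hze : ∀ v, z v ≤ y v * Real.exp (e v) := by
    intro v
    refine le_trans ?_ (mul_le_mul_of_nonneg_left (Real.add_one_le_exp (e v)) (hy v).le)
    by_cases hv : v = v₀
    · subst hv
      simp only [e, if_true]
      refine hv₀.trans (le_of_eq ?_)
      rw [← htr]
      ring
    · simp only [e, if_neg hv]
      refine (hother v hv).trans ?_
      have h1 : r ≤ κ * y v * t := by
        rw [← htr, mul_comm]
        exact mul_le_mul_of_nonneg_right (hratio v) ht
      nlinarith
  have hsum : ∑ v, e v ≤ 0 := by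
    have h1 : ∑ v ∈ Finset.univ.erase v₀, e v ≤ ∑ v : V, κ * c * t := by
      calc ∑ v ∈ Finset.univ.erase v₀, e v = ∑ v ∈ Finset.univ.erase v₀, κ * c * t :=
            Finset.sum_congr rfl fun v hv => if_neg (Finset.ne_of_mem_erase hv)
        _ ≤ _ := Finset.sum_le_sum_of_subset_of_nonneg (Finset.erase_subset _ _)
            fun _ _ _ => by positivity
    rw [Finset.sum_const, Finset.card_univ, nsmul_eq_mul] at h1
    rw [← Finset.add_sum_erase _ _ (Finset.mem_univ v₀)]
    have h2 : e v₀ = -(d * t) := if_pos rfl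
    have h3 := mul_le_mul_of_nonneg_right hd ht
    linarith
  calc ∏ v, z v ≤ ∏ v, y v * Real.exp (e v) :=
        Finset.prod_le_prod (fun v _ => (hz v).le) fun v _ => hze v
    _ = (∏ v, y v) * Real.exp (∑ v, e v) := by rw [Finset.prod_mul_distrib, Real.exp_sum]
    _ ≤ (∏ v, y v) * 1 := by
        gcongr
        · exact Finset.prod_nonneg fun v _ => (hy v).le
        · exact Real.exp_le_one_iff.mpr hsum
    _ = _ := mul_one _

theorem realEmbedding_le_of_norm_le (htr : ∀ φ : K →+* ℂ, ComplexEmbedding.IsReal φ)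
    {κ : ℝ} (hκ : 0 < κ) {α : 𝓞 K} (hα : ∀ v w : K →+* ℝ, v (α : K) ≤ κ * w (α : K))
    {X : ℝ} (hX : 0 < X) (hnorm : ((Algebra.norm ℤ α : ℤ) : ℝ) ≤ X ^ Module.finrank ℚ K)
    (v : K →+* ℝ) : v (α : K) ≤ κ * X := by
  by_contra! hlt
  have hw : ∀ w : K →+* ℝ, X < w (α : K) := fun w =>
    lt_of_mul_lt_mul_left (hlt.trans_le (hα v w)) hκ.le
  have h : ∏ w : K →+* ℝ, X < ∏ w : K →+* ℝ, w (α : K) :=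
    Finset.prod_lt_prod_of_nonempty (fun _ _ => hX) (fun w _ => hw w) ⟨v, Finset.mem_univ v⟩
  rw [Finset.prod_const, Finset.card_univ, card_realEmbedding htr,
    ← norm_eq_prod_realEmbedding htr] at h
  linarith

theorem sub_le_of_norm_crossing (htr : ∀ φ : K →+* ℂ, ComplexEmbedding.IsReal φ)
    {κ c r x : ℝ} (hκ : 0 ≤ κ) (hc : 0 ≤ c) (hr : 0 ≤ r) {α β δ : 𝓞 K} {v₀ : K →+* ℝ}
    (hβ : TotPos β) (hratio : ∀ v w : K →+* ℝ, v (β : K) ≤ κ * w (β : K))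
    (hδ : ∀ v : K →+* ℝ, |v (δ : K)| ≤ c * r) (hpos : TotPos (α + δ))
    (hle : ((Algebra.norm ℤ β : ℤ) : ℝ) ≤ x) (hlt : x < ((Algebra.norm ℤ (α + δ) : ℤ) : ℝ))
    (hnear : ∀ v : K →+* ℝ, v ≠ v₀ → |v (α : K) - v (β : K)| < r) :
    v₀ (β : K) - v₀ (α : K) ≤ (c + Module.finrank ℚ K * (κ * (c + 1))) * r := by
  by_contra! hgt
  rw [norm_eq_prod_realEmbedding htr] at hle hlt
  have hadd : ∀ v : K →+* ℝ, v ((α + δ : 𝓞 K) : K) = v (α : K) + v (δ : K) := fun v => by simp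
  refine absurd (prod_le_prod_of_shift (v₀ := v₀) (c := c + 1)
    (d := Module.finrank ℚ K * (κ * (c + 1))) hβ hpos hκ (by linarith) hr
    (fun v => hratio v₀ v) (fun v hv => ?_) ?_ ?_) (not_le.mpr (hle.trans_lt hlt))
  · have h1 := (abs_lt.mp (hnear v hv)).2
    have h2 := (abs_le.mp (hδ v)).2
    simp only [hadd]
    linarith
  · have h2 := (abs_le.mp (hδ v₀)).2
    simp only [hadd]
    linarith
  · rw [card_realEmbedding htr]

theorem sub_le_of_trace_crossing (htr : ∀ φ : K →+* ℂ, ComplexEmbedding.IsReal φ)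
    {c r U : ℝ} (hr : 0 ≤ r) {α β δ u : 𝓞 K} {v₀ : K →+* ℝ}
    (hU : ∀ v : K →+* ℝ, |v (u : K)| ≤ U) (hu : v₀ (u : K) ≠ 1)
    (hδ : ∀ v : K →+* ℝ, |v (δ : K)| ≤ c * r)
    (h0 : ∀ γ ∈ ({α, β} : Set (𝓞 K)), 0 ≤ ∑ v : K →+* ℝ, (v (u : K) - 1) * v (γ : K))
    (h1 : ∀ γ ∈ ({α, β} : Set (𝓞 K)),
      ∑ v : K →+* ℝ, (v (u : K) - 1) * v ((γ + δ : 𝓞 K) : K) < 0)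
    (hnear : ∀ v : K →+* ℝ, v ≠ v₀ → |v (α : K) - v (β : K)| < r) :
    v₀ (β : K) - v₀ (α : K) ≤
      (Module.finrank ℚ K * ((U + 1) * (c + 1))) / |v₀ (u : K) - 1| * r := by
  have hU0 : 0 ≤ U := (abs_nonneg _).trans (hU v₀)
  have hu1 : ∀ v : K →+* ℝ, |v (u : K) - 1| ≤ U + 1 := fun v => by
    have := abs_le.mp (hU v)
    rw [abs_le]
    constructor <;> linarith
  have hE : |∑ v : K →+* ℝ, (v (u : K) - 1) * v (δ : K)| ≤
      Module.finrank ℚ K * ((U + 1) * (c * r)) := by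
    refine (Finset.abs_sum_le_sum_abs _ _).trans ?_
    rw [← card_realEmbedding htr, ← Finset.card_univ, ← nsmul_eq_mul]
    refine Finset.sum_le_card_nsmul _ _ _ fun v _ => ?_
    rw [abs_mul]
    exact mul_le_mul (hu1 v) (hδ v) (abs_nonneg _) (by linarith)
  have hlt : ∀ γ ∈ ({α, β} : Set (𝓞 K)), ∑ v : K →+* ℝ, (v (u : K) - 1) * v (γ : K) ≤
      Module.finrank ℚ K * ((U + 1) * (c * r)) := by
    intro γ hγ
    have h := h1 γ hγ
    simp only [map_add, mul_add, Finset.sum_add_distrib] at h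
    have := neg_abs_le (∑ v : K →+* ℝ, (v (u : K) - 1) * v (δ : K))
    linarith
  have hdiff : |∑ v : K →+* ℝ, (v (u : K) - 1) * (v (β : K) - v (α : K))| ≤
      Module.finrank ℚ K * ((U + 1) * (c * r)) := by
    simp only [mul_sub _ (_ : ℝ) (_ : ℝ), Finset.sum_sub_distrib]
    have ha := h0 α (by simp)
    have hb := h0 β (by simp)
    have ha' := hlt α (by simp)
    have hb' := hlt β (by simp)
    rw [abs_le]
    constructor <;> linarith
  have hrest : |∑ v ∈ Finset.univ.erase v₀, (v (u : K) - 1) * (v (β : K) - v (α : K))| ≤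
      Module.finrank ℚ K * ((U + 1) * r) := by
    refine (Finset.abs_sum_le_sum_abs _ _).trans ?_
    calc ∑ v ∈ Finset.univ.erase v₀, |(v (u : K) - 1) * (v (β : K) - v (α : K))|
        ≤ ∑ v ∈ Finset.univ.erase v₀, (U + 1) * r := by
          refine Finset.sum_le_sum fun v hv => ?_
          rw [abs_mul, abs_sub_comm (v (β : K))]
          exact mul_le_mul (hu1 v) (hnear v (Finset.ne_of_mem_erase hv)).le (abs_nonneg _)
            (by linarith)
      _ ≤ ∑ v : K →+* ℝ, (U + 1) * r :=
          Finset.sum_le_sum_of_subset_of_nonneg (Finset.erase_subset _ _)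
            fun _ _ _ => by positivity
      _ = _ := by
          rw [Finset.sum_const, Finset.card_univ, card_realEmbedding htr, nsmul_eq_mul]
  rw [← Finset.add_sum_erase _ _ (Finset.mem_univ v₀)] at hdiff
  have hpos : 0 < |v₀ (u : K) - 1| := abs_pos.mpr (sub_ne_zero.mpr hu)
  rw [div_mul_eq_mul_div, le_div_iff₀ hpos]
  calc (v₀ (β : K) - v₀ (α : K)) * |v₀ (u : K) - 1|
      ≤ |v₀ (β : K) - v₀ (α : K)| * |v₀ (u : K) - 1| := by
        gcongr
        exact le_abs_self _
    _ = |(v₀ (u : K) - 1) * (v₀ (β : K) - v₀ (α : K))| := by rw [abs_mul, mul_comm]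
    _ ≤ Module.finrank ℚ K * ((U + 1) * (c + 1)) * r := by
        have h2 := abs_le.mp hdiff
        have h3 := abs_le.mp hrest
        rw [abs_le]
        constructor <;> nlinarith

/-- Points of `𝒟̄` far from the coordinate hyperplanes can only be moved out of `𝒟̄` across
the hyperplanes given by finitely many units. -/
theorem exists_unit_of_not_inDbar (htr : ∀ φ : K →+* ℂ, ComplexEmbedding.IsReal φ)
    {κ ρ : ℝ} (hρ : 0 ≤ ρ) {α δ : 𝓞 K}
    (hratio : ∀ v w : K →+* ℝ, v (α : K) ≤ κ * w (α : K))
    (hδ : ∀ v : K →+* ℝ, |v (δ : K)| ≤ ρ) (hfar : ∀ v : K →+* ℝ, 2 * ρ < v (α : K))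
    (hnot : ¬ InDbar (α + δ)) :
    ∃ u : (𝓞 K)ˣ, TotPos (u : 𝓞 K) ∧
      (∀ v : K →+* ℝ, |v ((u : 𝓞 K) : K)| ≤ 4 * Module.finrank ℚ K * κ) ∧
      ∑ v : K →+* ℝ, (v ((u : 𝓞 K) : K) - 1) * v ((α + δ : 𝓞 K) : K) < 0 := by
  have hadd : ∀ v : K →+* ℝ, v ((α + δ : 𝓞 K) : K) = v (α : K) + v (δ : K) := fun v => by simp
  have hlow : ∀ v : K →+* ℝ, v (α : K) / 2 ≤ v ((α + δ : 𝓞 K) : K) := fun v => by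
    have := abs_le.mp (hδ v)
    have := hfar v
    rw [hadd]
    linarith
  have hhigh : ∀ v : K →+* ℝ, v ((α + δ : 𝓞 K) : K) ≤ 2 * v (α : K) := fun v => by
    have := abs_le.mp (hδ v)
    have := hfar v
    rw [hadd]
    linarith
  have hpos : ∀ v : K →+* ℝ, 0 < v (α : K) := fun v => by linarith [hfar v]
  have hpos' : TotPos (α + δ) := fun v => by linarith [hlow v, hpos v]
  simp only [InDbar, not_and, not_forall, ge_iff_le, not_le] at hnot
  obtain ⟨u, hu, hlt⟩ := hnot hpos'
  refine ⟨u, hu, fun v => ?_, ?_⟩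
  · rw [abs_of_pos (hu v)]
    have h1 : v ((u : 𝓞 K) : K) * v ((α + δ : 𝓞 K) : K) ≤
        ∑ w : K →+* ℝ, w ((u : 𝓞 K) : K) * w ((α + δ : 𝓞 K) : K) :=
      Finset.single_le_sum (f := fun w : K →+* ℝ => w ((u : 𝓞 K) : K) * w ((α + δ : 𝓞 K) : K))
        (fun w _ => (mul_pos (hu w) (hpos' w)).le) (Finset.mem_univ v)
    have h2 : ∑ w : K →+* ℝ, w ((α + δ : 𝓞 K) : K) ≤
        Module.finrank ℚ K * (2 * (κ * v (α : K))) := by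
      rw [← card_realEmbedding htr, ← Finset.card_univ, ← nsmul_eq_mul]
      exact Finset.sum_le_card_nsmul _ _ _ fun w _ => by linarith [hhigh w, hratio w v]
    have h3 : v ((u : 𝓞 K) : K) * (v (α : K) / 2) ≤
        v ((u : 𝓞 K) : K) * v ((α + δ : 𝓞 K) : K) :=
      mul_le_mul_of_nonneg_left (hlow v) (hu v).le
    refine le_of_mul_le_mul_right (a := v (α : K)) ?_ (hpos v)
    linarith
  · simp only [sub_mul, one_mul, Finset.sum_sub_distrib]
    linarith

/-- The points of `𝒟̄` of norm at most `x` congruent to `ν` modulo `𝔪`. -/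
def regionCong (x : ℝ) (𝔪 : Ideal (𝓞 K)) (ν : 𝓞 K) : Set (𝓞 K) :=
  {α | InDbar α ∧ ((Algebra.norm ℤ α : ℤ) : ℝ) ≤ x ∧ α - ν ∈ 𝔪}

theorem ncountCong_eq_ncard (x : ℝ) (𝔪 : Ideal (𝓞 K)) (ν : 𝓞 K) :
    NcountCong x 𝔪 ν = (regionCong x 𝔪 ν).ncard :=
  Nat.card_coe_set_eq _

theorem finite_inDbar_norm_le (htr : ∀ φ : K →+* ℂ, ComplexEmbedding.IsReal φ)
    {X : ℝ} (hX : 0 < X) :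
    {α : 𝓞 K | InDbar α ∧ ((Algebra.norm ℤ α : ℤ) : ℝ) ≤ X ^ Module.finrank ℚ K}.Finite := by
  obtain ⟨κ, hκ, hratio⟩ := exists_ratio_bound htr
  refine (finite_of_realEmbedding_abs_le htr (κ * X)).subset fun α hα v => ?_
  rw [abs_of_pos (hα.1.1 v)]
  exact realEmbedding_le_of_norm_le htr (by linarith) (hratio α hα.1) hX hα.2 v

/-- A short translation moves `O(X ^ (n - 1))` points of a residue class out of the region. -/
theorem exists_crossing_bound (htr : ∀ φ : K →+* ℂ, ComplexEmbedding.IsReal φ)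
    {c : ℝ} (hc : 0 ≤ c) :
    ∃ C : ℝ, 0 ≤ C ∧ ∀ (𝔪 : Ideal (𝓞 K)) (r X : ℝ), 1 ≤ r →
      r ^ Module.finrank ℚ K = Ideal.absNorm 𝔪 → 1 ≤ X → ∀ ν δ : 𝓞 K,
      (∀ v : K →+* ℝ, |v (δ : K)| ≤ c * r) →
      ({α ∈ regionCong (X ^ Module.finrank ℚ K) 𝔪 ν | ¬ (InDbar (α + δ) ∧
        ((Algebra.norm ℤ (α + δ) : ℤ) : ℝ) ≤ X ^ Module.finrank ℚ K)}.ncard : ℝ) ≤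
        C * X ^ (Module.finrank ℚ K - 1) := by
  obtain ⟨κ, hκ, hratio⟩ := exists_ratio_bound htr
  let n := Module.finrank ℚ K
  obtain ⟨v₀⟩ : Nonempty (K →+* ℝ) := by
    rw [← Fintype.card_pos_iff, card_realEmbedding htr]
    exact Module.finrank_pos
  let U : ℝ := 4 * n * κ
  have hfin : {u : (𝓞 K)ˣ | ∀ v : K →+* ℝ, |v ((u : 𝓞 K) : K)| ≤ U}.Finite :=
    (finite_of_realEmbedding_abs_le htr U).preimage Units.val_injective.injOn
  let F : Finset (𝓞 K)ˣ := hfin.toFinset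
  let M₁ : ℕ := ⌈2 * κ * c⌉₊
  let M₂ : ℕ := ⌈c + n * (κ * (c + 1))⌉₊
  let M₃ : (𝓞 K)ˣ → ℕ := fun u => ⌈(n * ((U + 1) * (c + 1))) / |v₀ ((u : 𝓞 K) : K) - 1|⌉₊
  refine ⟨((M₁ + 2) + (M₂ + 2) + ∑ u ∈ F, ((M₃ u : ℝ) + 2)) * (2 * κ) ^ (n - 1), by positivity,
    fun 𝔪 r X hr1 hr hX ν δ hδ => ?_⟩
  have hr0 : 0 ≤ r := by linarith
  have hL : 1 ≤ κ * X := one_le_mul_of_one_le_of_one_le hκ hX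
  set A := regionCong (X ^ Module.finrank ℚ K) 𝔪 ν
  have hslab : ∀ (M : ℕ) (S : Set (𝓞 K)), S ⊆ A →
      (∀ α ∈ S, ∀ β ∈ S, (∀ v : K →+* ℝ, v ≠ v₀ → |v (α : K) - v (β : K)| < r) →
        v₀ (β : K) - v₀ (α : K) ≤ M * r) →
      S.Finite ∧ (S.ncard : ℝ) ≤ (M + 2) * (2 * (κ * X)) ^ (n - 1) := by
    intro M S hSA hS
    refine ncard_le_of_slab htr 𝔪 hr1 hr v₀ hL M S (fun α hα β hβ => ?_) (fun α hα v => ?_) hS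
    · have := 𝔪.sub_mem (hSA hα).2.2 (hSA hβ).2.2
      simpa using this
    · exact ⟨((hSA hα).1.1 v).le, realEmbedding_le_of_norm_le htr (by linarith)
        (hratio α (hSA hα).1) (by linarith) (hSA hα).2.1 v⟩
  let S₁ : Set (𝓞 K) := {α ∈ A | ∃ v : K →+* ℝ, v (α : K) ≤ 2 * (c * r)}
  let S₂ : Set (𝓞 K) := {α ∈ A | TotPos (α + δ) ∧
    X ^ Module.finrank ℚ K < ((Algebra.norm ℤ (α + δ) : ℤ) : ℝ)}
  let S₃ : (𝓞 K)ˣ → Set (𝓞 K) := fun u => {α ∈ A | TotPos (u : 𝓞 K) ∧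
    ∑ v : K →+* ℝ, (v ((u : 𝓞 K) : K) - 1) * v ((α + δ : 𝓞 K) : K) < 0}
  have h₁ := hslab M₁ S₁ (fun α hα => hα.1) (by
    rintro α ⟨hα, -⟩ β ⟨hβ, v, hv⟩ -
    have h1 := hratio β hβ.1 v₀ v
    have h2 : κ * v (β : K) ≤ κ * (2 * (c * r)) := mul_le_mul_of_nonneg_left hv (by linarith)
    have h3 := mul_le_mul_of_nonneg_right (Nat.le_ceil (2 * κ * c)) hr0
    have h4 := hα.1.1 v₀
    linarith)
  have h₂ := hslab M₂ S₂ (fun α hα => hα.1) (by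
    rintro α ⟨-, hpos, hlt⟩ β ⟨hβ, -⟩ hnear
    exact (sub_le_of_norm_crossing htr (by linarith) hc hr0 hβ.1.1 (hratio β hβ.1) hδ hpos
      hβ.2.1 hlt hnear).trans (mul_le_mul_of_nonneg_right (Nat.le_ceil _) hr0))
  have h₃ : ∀ u ∈ F, (S₃ u).Finite ∧
      ((S₃ u).ncard : ℝ) ≤ (M₃ u + 2) * (2 * (κ * X)) ^ (n - 1) := by
    intro u hu
    refine hslab (M₃ u) (S₃ u) (fun α hα => hα.1) ?_
    rintro α ⟨hα, hpos, hα'⟩ β ⟨hβ, -, hβ'⟩ hnear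
    have hu1 : v₀ ((u : 𝓞 K) : K) ≠ 1 := by
      intro h
      have h1 : ((u : 𝓞 K) : K) = 1 := v₀.injective (by rw [h, map_one])
      simp [h1] at hα'
    refine (sub_le_of_trace_crossing htr hr0 (hfin.mem_toFinset.mp hu) hu1 hδ ?_ ?_
      hnear).trans (mul_le_mul_of_nonneg_right (Nat.le_ceil _) hr0)
    · have key : ∀ γ ∈ A, 0 ≤ ∑ v : K →+* ℝ, (v ((u : 𝓞 K) : K) - 1) * v (γ : K) := by
        intro γ hγ
        have := hγ.1.2 u hpos
        simp only [sub_mul, one_mul, Finset.sum_sub_distrib]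
        linarith
      rintro γ (rfl | rfl)
      exacts [key _ hα, key _ hβ]
    · rintro γ (rfl | rfl)
      exacts [hα', hβ']
  have hcover : {α ∈ A | ¬ (InDbar (α + δ) ∧
      ((Algebra.norm ℤ (α + δ) : ℤ) : ℝ) ≤ X ^ Module.finrank ℚ K)} ⊆
      (S₁ ∪ S₂) ∪ ⋃ u ∈ F, S₃ u := by
    rintro α ⟨hα, hnot⟩
    by_cases hsmall : ∃ v : K →+* ℝ, v (α : K) ≤ 2 * (c * r)
    · exact Or.inl (Or.inl ⟨hα, hsmall⟩)
    push Not at hsmall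
    by_cases hD : InDbar (α + δ)
    · exact Or.inl (Or.inr ⟨hα, hD.1, not_le.mp fun h => hnot ⟨hD, h⟩⟩)
    obtain ⟨u, hu, hle, hlt⟩ := exists_unit_of_not_inDbar htr (by positivity)
      (hratio α hα.1) hδ hsmall hD
    exact Or.inr (Set.mem_biUnion (x := u) (hfin.mem_toFinset.mpr hle) ⟨hα, hu, hlt⟩)
  have hfinU : ((S₁ ∪ S₂) ∪ ⋃ u ∈ F, S₃ u).Finite :=
    (h₁.1.union h₂.1).union (F.finite_toSet.biUnion fun u hu => (h₃ u hu).1)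
  have hcard : (((S₁ ∪ S₂) ∪ ⋃ u ∈ F, S₃ u).ncard : ℝ) ≤
      S₁.ncard + S₂.ncard + ∑ u ∈ F, ((S₃ u).ncard : ℝ) := by
    have h1 := Set.ncard_union_le (S₁ ∪ S₂) (⋃ u ∈ F, S₃ u)
    have h2 := Set.ncard_union_le S₁ S₂
    have h3 := F.set_ncard_biUnion_le S₃
    exact_mod_cast h1.trans (add_le_add h2 h3)
  calc _ ≤ (((S₁ ∪ S₂) ∪ ⋃ u ∈ F, S₃ u).ncard : ℝ) := by
        exact_mod_cast Set.ncard_le_ncard hcover hfinU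
    _ ≤ _ := hcard
    _ ≤ (M₁ + 2) * (2 * (κ * X)) ^ (n - 1) + (M₂ + 2) * (2 * (κ * X)) ^ (n - 1) +
        ∑ u ∈ F, (M₃ u + 2) * (2 * (κ * X)) ^ (n - 1) :=
        add_le_add (add_le_add h₁.2 h₂.2) (Finset.sum_le_sum fun u hu => (h₃ u hu).2)
    _ = ((M₁ + 2) + (M₂ + 2) + ∑ u ∈ F, ((M₃ u : ℝ) + 2)) * (2 * κ) ^ (n - 1) * X ^ (n - 1) := by
        rw [← Finset.sum_mul, ← mul_assoc, mul_pow]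
        ring

theorem exists_ncountCong_le_add (htr : ∀ φ : K →+* ℂ, ComplexEmbedding.IsReal φ) :
    ∃ C : ℝ, 0 ≤ C ∧ ∀ 𝔪 : Ideal (𝓞 K), 𝔪 ≠ ⊥ → ∀ (ν ν' : 𝓞 K) (X : ℝ), 1 ≤ X →
      (NcountCong (X ^ Module.finrank ℚ K) 𝔪 ν : ℝ) ≤
        NcountCong (X ^ Module.finrank ℚ K) 𝔪 ν' + C * X ^ (Module.finrank ℚ K - 1) := by
  obtain ⟨c, hc, hshort⟩ := exists_short_representative K
  obtain ⟨C, hC, hcross⟩ := exists_crossing_bound htr hc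
  refine ⟨C, hC, fun 𝔪 h𝔪 ν ν' X hX => ?_⟩
  have hN : (1 : ℝ) ≤ Ideal.absNorm 𝔪 := by
    exact_mod_cast Nat.one_le_iff_ne_zero.mpr (Ideal.absNorm_ne_zero_iff_mem_nonZeroDivisors.mpr
      (mem_nonZeroDivisors_of_ne_zero h𝔪))
  have hn : Module.finrank ℚ K ≠ 0 := Module.finrank_pos.ne'
  let r : ℝ := (Ideal.absNorm 𝔪 : ℝ) ^ ((Module.finrank ℚ K : ℝ)⁻¹)
  have hr : r ^ Module.finrank ℚ K = Ideal.absNorm 𝔪 :=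
    Real.rpow_inv_natCast_pow (by linarith) hn
  have hr1 : 1 ≤ r := Real.one_le_rpow hN (by positivity)
  obtain ⟨δ, hδ𝔪, hδ⟩ := hshort 𝔪 h𝔪 r (by linarith) hr (ν' - ν)
  have hS := hcross 𝔪 r X hr1 hr hX ν δ hδ
  have hfin : ∀ ν : 𝓞 K, (regionCong (X ^ Module.finrank ℚ K) 𝔪 ν).Finite := fun ν =>
    (finite_inDbar_norm_le htr (by linarith)).subset fun α hα => ⟨hα.1, hα.2.1⟩
  rw [ncountCong_eq_ncard, ncountCong_eq_ncard]
  set A := regionCong (X ^ Module.finrank ℚ K) 𝔪 ν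
  set A' := regionCong (X ^ Module.finrank ℚ K) 𝔪 ν'
  set S := {α ∈ A | ¬ (InDbar (α + δ) ∧
    ((Algebra.norm ℤ (α + δ) : ℤ) : ℝ) ≤ X ^ Module.finrank ℚ K)}
  have h1 : (A \ S).ncard ≤ A'.ncard := by
    refine Set.ncard_le_ncard_of_injOn (· + δ) (fun α hα => ?_)
      (add_left_injective δ).injOn (hfin ν')
    obtain ⟨hαA, hαS⟩ := hα
    have h : InDbar (α + δ) ∧
        ((Algebra.norm ℤ (α + δ) : ℤ) : ℝ) ≤ X ^ Module.finrank ℚ K := by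
      by_contra hcon
      exact hαS ⟨hαA, hcon⟩
    refine ⟨h.1, h.2, ?_⟩
    have := 𝔪.sub_mem hαA.2.2 hδ𝔪
    convert this using 1
    ring
  have h2 : A.ncard ≤ A'.ncard + S.ncard :=
    (Set.ncard_le_ncard_sdiff_add_ncard A S ((hfin ν).subset fun α hα => hα.1)).trans
      (Nat.add_le_add_right h1 _)
  have h2' : (A.ncard : ℝ) ≤ A'.ncard + S.ncard := by exact_mod_cast h2
  linarith

theorem ncount_eq_sum_ncountCong (htr : ∀ φ : K →+* ℂ, ComplexEmbedding.IsReal φ)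
    (𝔪 : Ideal (𝓞 K)) [Fintype (𝓞 K ⧸ 𝔪)] {X : ℝ} (hX : 0 < X) :
    Ncount (K := K) (X ^ Module.finrank ℚ K) =
      ∑ a : 𝓞 K ⧸ 𝔪, NcountCong (X ^ Module.finrank ℚ K) 𝔪 a.out := by
  let T : Set (𝓞 K) :=
    {α | InDbar α ∧ ((Algebra.norm ℤ α : ℤ) : ℝ) ≤ X ^ Module.finrank ℚ K}
  have hT : T.Finite := finite_inDbar_norm_le htr hX
  have h1 : Ncount (K := K) (X ^ Module.finrank ℚ K) = hT.toFinset.card := by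
    rw [← Set.ncard_eq_toFinset_card T hT]
    exact Nat.card_coe_set_eq T
  rw [h1, Finset.card_eq_sum_card_fiberwise (f := Ideal.Quotient.mk 𝔪) (t := Finset.univ)
    fun _ _ => Finset.mem_coe.mpr (Finset.mem_univ _)]
  refine Finset.sum_congr rfl fun a _ => ?_
  rw [ncountCong_eq_ncard, ← Set.ncard_coe_finset]
  congr 1
  ext α
  have ha : Ideal.Quotient.mk 𝔪 a.out = a := Quotient.out_eq' a
  have hmem : α - a.out ∈ 𝔪 ↔ Ideal.Quotient.mk 𝔪 α = a := by
    rw [← Ideal.Quotient.eq, ha]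
  simp [regionCong, T, hmem, and_assoc]

/-- **Lemma 3.6** (Friedlander–Iwaniec–Mazur–Rubin, "The spin of prime ideals").
Let `K/ℚ` be totally real cyclic Galois of degree `n ≥ 3` with all totally positive units
squares.  There is a constant `C` depending only on `K` such that for every nonzero ideal
`𝔪`, every `ν` and every `x ≥ 1`,
`|𝒩(x; 𝔪, ν) − 𝒩(x)/N𝔪| ≤ C x^{1−1/n}`. -/
theorem spins_of_prime_ideals_stmt19
    (n : ℕ) (hn : 3 ≤ n)
    (K : Type*) [Field K] [NumberField K] [IsGalois ℚ K]
    (hdeg : Module.finrank ℚ K = n)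
    (htotreal : ∀ φ : K →+* ℂ, ComplexEmbedding.IsReal φ)
    (hcyc : IsCyclic (K ≃ₐ[ℚ] K))
    (hunits : ∀ u : (𝓞 K)ˣ, TotPos (u : 𝓞 K) → ∃ w : (𝓞 K)ˣ, u = w ^ 2) :
    ∃ C : ℝ, 0 < C ∧
      ∀ 𝔪 : Ideal (𝓞 K), 𝔪 ≠ ⊥ → ∀ ν : 𝓞 K, ∀ x : ℝ, 1 ≤ x →
        |(NcountCong x 𝔪 ν : ℝ) - (Ncount (K := K) x : ℝ) / (Ideal.absNorm 𝔪 : ℝ)|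
          ≤ C * x ^ (1 - 1 / (n : ℝ)) := by
  subst hdeg
  obtain ⟨C, hC, hle⟩ := exists_ncountCong_le_add htotreal
  refine ⟨C + 1, by linarith, fun 𝔪 h𝔪 ν x hx => ?_⟩
  have hn0 : Module.finrank ℚ K ≠ 0 := by omega
  obtain ⟨X, hX, rfl⟩ : ∃ X : ℝ, 1 ≤ X ∧ X ^ Module.finrank ℚ K = x :=
    ⟨x ^ ((Module.finrank ℚ K : ℝ)⁻¹), Real.one_le_rpow hx (by positivity),
      Real.rpow_inv_natCast_pow (by linarith) hn0⟩
  have hpow : (X ^ Module.finrank ℚ K) ^ (1 - 1 / (Module.finrank ℚ K : ℝ)) =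
      X ^ (Module.finrank ℚ K - 1) := by
    rw [← Real.rpow_natCast, ← Real.rpow_mul (by linarith), ← Real.rpow_natCast,
      Nat.cast_sub (by omega)]
    congr 1
    field_simp
    simp
  rw [hpow]
  have : Finite (𝓞 K ⧸ 𝔪) := Ideal.finiteQuotientOfFreeOfNeBot 𝔪 h𝔪
  have := Fintype.ofFinite (𝓞 K ⧸ 𝔪)
  have hcard : (Ideal.absNorm 𝔪 : ℝ) = (Finset.univ : Finset (𝓞 K ⧸ 𝔪)).card := by
    rw [Ideal.absNorm_apply, Submodule.cardQuot_apply, Nat.card_eq_fintype_card,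
      Finset.card_univ]
  have hpos : (0 : ℝ) < Ideal.absNorm 𝔪 := by
    rw [hcard, Finset.card_univ]
    exact_mod_cast Fintype.card_pos
  have hsum := ncount_eq_sum_ncountCong htotreal 𝔪 (X := X) (by linarith)
  have hE : 0 ≤ X ^ (Module.finrank ℚ K - 1) := by positivity
  have hup : (Ncount (K := K) (X ^ Module.finrank ℚ K) : ℝ) ≤ Ideal.absNorm 𝔪 *
      (NcountCong (X ^ Module.finrank ℚ K) 𝔪 ν + C * X ^ (Module.finrank ℚ K - 1)) := by
    rw [hsum, hcard, ← nsmul_eq_mul, Nat.cast_sum]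
    exact Finset.sum_le_card_nsmul _ _ _ fun a _ => hle 𝔪 h𝔪 a.out ν X hX
  have hlow : Ideal.absNorm 𝔪 *
      (NcountCong (X ^ Module.finrank ℚ K) 𝔪 ν - C * X ^ (Module.finrank ℚ K - 1)) ≤
      (Ncount (K := K) (X ^ Module.finrank ℚ K) : ℝ) := by
    rw [hsum, hcard, ← nsmul_eq_mul, Nat.cast_sum]
    exact Finset.card_nsmul_le_sum _ _ _ fun a _ => by linarith [hle 𝔪 h𝔪 ν a.out X hX]
  rw [abs_le]
  constructor
  · have := (div_le_iff₀' hpos).mpr hup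
    linarith
  · have := (le_div_iff₀' hpos).mpr hlow
    linarith

end
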